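/- Every finite simple graph G with at least one vertex contains a 2-cheap set. -/

import Mathlib

open SimpleGraph Finset

/-- The minimum degree of a subgraph `H` of `G`: the infimum over vertices of `H`
of the number of neighbors in `H`. -/
noncomputable def subMinDeg {V : Type*} (G : SimpleGraph V) (H : G.Subgraph) : ℕ :=
  sInf ((fun v => (H.neighborSet v).ncard) '' H.verts)

/-- The degenerate degree `ζ(v)`: the maximum of `δ(H)` over all subgraphs `H` of `G`
containing `v`. -/
noncomputable def zeta {V : Type*} (G : SimpleGraph V) (v : V) : ℕ :=
  sSup {n | ∃ H : G.Subgraph, v ∈ H.verts ∧ subMinDeg G H = n}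

/-- A vertex `u` is cheap if `ζ(u) = deg_G(u)` and `ζ(u) ≤ ζ(w)` for every `w ∈ N[u]`. -/
def Cheap {V : Type*} (G : SimpleGraph V) (u : V) : Prop :=
  zeta G u = (G.neighborSet u).ncard ∧ ∀ w, G.Adj u w → zeta G u ≤ zeta G w

/-- A nonempty finite set of vertices is 2-cheap if it consists of isolated vertices, or
consists of non-isolated vertices, induces a subgraph of maximum degree at most 2, and
satisfies `∑_{v ∈ N[S]} 1/(ζ(v)+1/3) ≤ |S|`. -/
def TwoCheap {V : Type*} [Fintype V] [DecidableEq V] (G : SimpleGraph V)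
    [DecidableRel G.Adj] (S : Finset V) : Prop :=
  S.Nonempty ∧
    ((∀ v ∈ S, G.degree v = 0) ∨
      ((∀ v ∈ S, 0 < G.degree v) ∧ (∀ v ∈ S, (S.filter (G.Adj v)).card ≤ 2) ∧
        (∑ v ∈ Finset.univ.filter (fun v => v ∈ S ∨ ∃ u ∈ S, G.Adj u v),
          (1 : ℝ) / (zeta G v + 1/3)) ≤ S.card))


set_option linter.unusedSectionVars false

section Helpers

variable {V : Type*} [Fintype V] [DecidableEq V] (G : SimpleGraph V) [DecidableRel G.Adj]

/-- neighbours inside `B` -/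
def nb (B : Finset V) (v : V) : Finset V := B.filter (G.Adj v)

/-- closed neighbourhood inside `B` -/
def cn (B : Finset V) (v : V) : Finset V := insert v (nb G B v)

/-- `v` has a neighbour outside `B`. -/
def Dec (B : Finset V) (v : V) : Prop := ∃ z, z ∉ B ∧ G.Adj v z

/-- outside vertices having a neighbour in `X` -/
def outT (B X : Finset V) : Finset V := univ.filter (fun z => z ∉ B ∧ ∃ y ∈ X, G.Adj z y)

/-- no cheap sets -/
def NoCheap (f : V → ℝ) : Prop := ∀ S : Finset V, S.Nonempty → (∀ v ∈ S, 0 < G.degree v) →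
  (∀ v ∈ S, (S.filter (G.Adj v)).card ≤ 2) →
  (S.card : ℝ) < ∑ v ∈ univ.filter (fun v => v ∈ S ∨ ∃ u ∈ S, G.Adj u v), f v

/-- `f` is bounded on dense sets -/
def FBound (f : V → ℝ) : Prop := ∀ (B : Finset V) (d : ℕ), (∀ v ∈ B, d ≤ (nb G B v).card) →
  ∀ v ∈ B, f v ≤ 3 / (3 * d + 1)

/-- The configuration used in the induction. -/
structure Conf (f : V → ℝ) (B : Finset V) (d : ℕ) : Prop where
  hd : 1 ≤ d
  hB : ∀ v ∈ B, d ≤ (nb G B v).card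
  out1 : ∀ v ∈ B, ∀ z z', z ∉ B → z' ∉ B → G.Adj v z → G.Adj v z' → z = z'
  outB : ∀ z, z ∉ B → ∀ y, G.Adj z y → y ∈ B
  out2 : ∀ z, z ∉ B → (G.neighborFinset z).card ≤ 2
  gain : ∀ z, z ∉ B → ∀ y, G.Adj z y →
    f z + ∑ x ∈ (G.neighborFinset z).erase y, f x ≤ 1 - 1 / (3 * d + 1)

variable {G} {f : V → ℝ} {B : Finset V} {d : ℕ}

lemma mem_nb {u v : V} : v ∈ nb G B u ↔ v ∈ B ∧ G.Adj u v := by simp [nb]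

lemma mem_cn {u v : V} : v ∈ cn G B u ↔ v = u ∨ (v ∈ B ∧ G.Adj u v) := by simp [cn, nb]

lemma card_cn (u : V) : (cn G B u).card = (nb G B u).card + 1 := by
  rw [cn, card_insert_of_notMem]; simp [mem_nb]

lemma card_filter_le_erase (S : Finset V) (v : V) :
    (S.filter (G.Adj v)).card ≤ (S.erase v).card := by
  apply card_le_card
  intro x hx
  simp only [mem_filter] at hx
  exact mem_erase.2 ⟨hx.2.ne', hx.1⟩

lemma sum_biUnion_le' (f0 : ∀ v, 0 ≤ f v) (T : Finset V) (g : V → Finset V) :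
    ∑ x ∈ T.biUnion g, f x ≤ ∑ z ∈ T, ∑ x ∈ g z, f x := by
  induction T using Finset.induction_on with
  | empty => simp
  | insert a s ha ih =>
    rw [biUnion_insert, sum_insert ha]
    have := sum_union_inter (s₁ := g a) (s₂ := s.biUnion g) (f := f)
    have h2 : 0 ≤ ∑ x ∈ g a ∩ s.biUnion g, f x := sum_nonneg fun _ _ => f0 _
    linarith

lemma criterion (f0 : ∀ v, 0 ≤ f v) (H : NoCheap G f) (c : Conf G f B d) (S : Finset V)
    (hSB : S ⊆ B) (hne : S.Nonempty) (h2 : ∀ v ∈ S, (S.filter (G.Adj v)).card ≤ 2)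
    (h1 : ∀ v ∈ S, Dec G B v → (S.filter (G.Adj v)).card ≤ 1) :
    (S.card : ℝ) + (outT G B (S.biUnion (cn G B))).card / (3 * d + 1)
      < ∑ v ∈ S.biUnion (cn G B), f v := by
  set X := S.biUnion (cn G B) with hX
  set T := outT G B X with hT
  have hTm : ∀ z, z ∈ T ↔ z ∉ B ∧ ∃ y ∈ X, G.Adj z y := by intro z; simp [hT, outT]
  have hXm : ∀ x, x ∈ X ↔ ∃ u ∈ S, x = u ∨ (x ∈ B ∧ G.Adj u x) := by
    intro x; simp [hX, mem_cn]
  have hdisj : Disjoint S T := by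
    rw [Finset.disjoint_left]; intro a ha hb
    exact ((hTm a).1 hb).1 (hSB ha)
  have key := H (S ∪ T) (hne.mono subset_union_left) (by
    intro v hv
    rw [G.degree_pos_iff_exists_adj]
    rcases mem_union.1 hv with h | h
    · have := c.hB v (hSB h)
      have hd := c.hd
      obtain ⟨w, hw⟩ := card_pos.1 (by omega : 0 < (nb G B v).card)
      exact ⟨w, (mem_nb.1 hw).2⟩
    · obtain ⟨_, y, _, hy⟩ := (hTm v).1 h
      exact ⟨y, hy⟩) (by
    intro v hv
    rcases mem_union.1 hv with h | h
    · rw [filter_union]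
      refine (card_union_le _ _).trans ?_
      have hT1 : (T.filter (G.Adj v)).card ≤ 1 := by
        rw [card_le_one]
        intro a ha b hb
        simp only [mem_filter, hTm] at ha hb
        exact c.out1 v (hSB h) a b ha.1.1 hb.1.1 ha.2 hb.2
      by_cases hD : Dec G B v
      · have := h1 v h hD; omega
      · have : T.filter (G.Adj v) = ∅ := by
          rw [filter_eq_empty_iff]
          intro z hz hvz
          exact hD ⟨z, ((hTm z).1 hz).1, hvz⟩
        rw [this]; simpa using h2 v h
    · refine le_trans (card_le_card ?_) (c.out2 v ((hTm v).1 h).1)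
      intro x hx; simp only [mem_filter] at hx; simpa using hx.2)
  rw [card_union_of_disjoint hdisj] at key
  have hsub : univ.filter (fun v => v ∈ S ∪ T ∨ ∃ u ∈ S ∪ T, G.Adj u v) ⊆
      X ∪ T.biUnion (fun z => insert z (G.neighborFinset z \ X)) := by
    intro v hv
    simp only [mem_filter, mem_univ, true_and, mem_union] at hv
    simp only [mem_union, mem_biUnion, mem_insert, mem_sdiff, mem_neighborFinset]
    by_cases hvX : v ∈ X
    · exact Or.inl hvX
    right
    rcases hv with (h | h) | ⟨u, h | h, hu⟩
    · exact absurd ((hXm v).2 ⟨v, h, Or.inl rfl⟩) hvX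
    · exact ⟨v, h, Or.inl rfl⟩
    · by_cases hvB : v ∈ B
      · exact absurd ((hXm v).2 ⟨u, h, Or.inr ⟨hvB, hu⟩⟩) hvX
      · exact ⟨v, (hTm v).2 ⟨hvB, u, (hXm u).2 ⟨u, h, Or.inl rfl⟩, hu.symm⟩, Or.inl rfl⟩
    · exact ⟨u, h, Or.inr ⟨hu, hvX⟩⟩
  have e1 := sum_le_sum_of_subset_of_nonneg hsub (f := f) (fun _ _ _ => f0 _)
  have e2 := sum_union_inter (s₁ := X)
    (s₂ := T.biUnion (fun z => insert z (G.neighborFinset z \ X))) (f := f)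
  have e3 : 0 ≤ ∑ x ∈ X ∩ T.biUnion (fun z => insert z (G.neighborFinset z \ X)), f x :=
    sum_nonneg fun _ _ => f0 _
  have e4 := sum_biUnion_le' f0 T (fun z => insert z (G.neighborFinset z \ X))
  have e5 : ∑ z ∈ T, ∑ x ∈ insert z (G.neighborFinset z \ X), f x
      ≤ ∑ z ∈ T, (1 - 1 / (3 * (d:ℝ) + 1)) := by
    apply sum_le_sum
    intro z hz
    obtain ⟨hzB, y, hyX, hzy⟩ := (hTm z).1 hz
    refine le_trans ?_ (c.gain z hzB y hzy)
    rw [sum_insert (by simp)]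
    gcongr
    · exact fun _ _ _ => f0 _
    · intro x hx
      simp only [mem_sdiff, mem_neighborFinset] at hx
      simp only [mem_erase, mem_neighborFinset]
      exact ⟨fun h => hx.2 (h ▸ hyX), hx.1⟩
  rw [sum_const, nsmul_eq_mul] at e5
  push_cast at key
  have : (T.card : ℝ) * (1 - 1 / (3 * (d:ℝ) + 1)) = T.card - T.card / (3 * d + 1) := by ring
  linarith

lemma cnt (f0 : ∀ v, 0 ≤ f v) (hf : FBound G f) (H : NoCheap G f) (c : Conf G f B d)
    (S : Finset V)
    (hSB : S ⊆ B) (hne : S.Nonempty) (h2 : ∀ v ∈ S, (S.filter (G.Adj v)).card ≤ 2)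
    (h1 : ∀ v ∈ S, Dec G B v → (S.filter (G.Adj v)).card ≤ 1) :
    S.card * (3 * d + 1) + (outT G B (S.biUnion (cn G B))).card
      < 3 * (S.biUnion (cn G B)).card := by
  have h := criterion f0 H c S hSB hne h2 h1
  have hXB : S.biUnion (cn G B) ⊆ B := by
    intro x hx
    simp only [mem_biUnion, mem_cn] at hx
    obtain ⟨u, hu, rfl | h⟩ := hx
    · exact hSB hu
    · exact h.1
  have h3 : ∑ v ∈ S.biUnion (cn G B), f v ≤ ∑ v ∈ S.biUnion (cn G B), 3 / (3 * (d:ℝ) + 1) :=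
    sum_le_sum fun v hv => hf B d c.hB v (hXB hv)
  rw [sum_const, nsmul_eq_mul] at h3
  have h4 := h.trans_le h3
  have hp : (0:ℝ) < 3 * d + 1 := by positivity
  have h5 := mul_lt_mul_of_pos_right h4 hp
  have e1 : ((S.card : ℝ) + (outT G B (S.biUnion (cn G B))).card / (3 * d + 1)) * (3 * d + 1)
    = S.card * (3 * d + 1) + (outT G B (S.biUnion (cn G B))).card := by field_simp
  have e2 : ((S.biUnion (cn G B)).card : ℝ) * (3 / (3 * d + 1)) * (3 * d + 1)
    = 3 * (S.biUnion (cn G B)).card := by field_simp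
  rw [e1, e2] at h5
  exact_mod_cast h5

/-- weighted version -/
lemma wcnt (f0 : ∀ v, 0 ≤ f v) (hf : FBound G f) (H : NoCheap G f) (c : Conf G f B d)
    (S R B' : Finset V) (hR : S.biUnion (cn G B) ⊆ S ∪ R)
    (hB' : ∀ v ∈ B', d + 1 ≤ (nb G B' v).card) (hRB : R ⊆ B')
    (hSB : S ⊆ B) (hne : S.Nonempty) (h2 : ∀ v ∈ S, (S.filter (G.Adj v)).card ≤ 2)
    (h1 : ∀ v ∈ S, Dec G B v → (S.filter (G.Adj v)).card ≤ 1) :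
    (S.card : ℝ) + (outT G B (S.biUnion (cn G B))).card / (3 * d + 1)
      < S.card * (3 / (3 * d + 1)) + R.card * (3 / (3 * d + 4)) := by
  have h := criterion f0 H c S hSB hne h2 h1
  have e1 := sum_le_sum_of_subset_of_nonneg hR (f := f) (fun _ _ _ => f0 _)
  have e2 := sum_union_inter (s₁ := S) (s₂ := R) (f := f)
  have e3 : 0 ≤ ∑ x ∈ S ∩ R, f x := sum_nonneg fun _ _ => f0 _
  have h3 : ∑ v ∈ S, f v ≤ ∑ v ∈ S, 3 / (3 * (d:ℝ) + 1) :=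
    sum_le_sum fun v hv => hf B d c.hB v (hSB hv)
  have h4 : ∑ v ∈ R, f v ≤ ∑ v ∈ R, 3 / (3 * (d:ℝ) + 4) :=
    sum_le_sum fun v hv => (hf B' (d+1) hB' v (hRB hv)).trans (le_of_eq (by push_cast; ring))
  rw [sum_const, nsmul_eq_mul] at h3 h4
  linarith

lemma outT_pos {X : Finset V} {y : V} (hy : y ∈ X) (hD : Dec G B y) :
    1 ≤ (outT G B X).card := by
  obtain ⟨z, hz, hyz⟩ := hD
  exact card_pos.2 ⟨z, by simp only [outT, mem_filter, mem_univ, true_and]; exact ⟨hz, y, hy, hyz.symm⟩⟩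

lemma union_card {X Y I : Finset V} (h : I ⊆ X ∩ Y) :
    (X ∪ Y).card + I.card ≤ X.card + Y.card := by
  have := Finset.card_union_add_card_inter X Y
  have := card_le_card h
  omega

lemma deg2 {u v x : V} (huv : u ≠ v) (hx : x ∈ ({u, v} : Finset V)) :
    (({u, v} : Finset V).filter (G.Adj x)).card ≤ 1 := by
  refine (card_filter_le_erase _ _).trans ?_
  rw [card_erase_of_mem hx, card_pair huv]

lemma cnt2 (f0 : ∀ v, 0 ≤ f v) (hf : FBound G f) (H : NoCheap G f) (c : Conf G f B d)
    {u v : V} (hu : u ∈ B) (hv : v ∈ B) (huv : u ≠ v) :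
    2 * (3 * d + 1) + (outT G B (cn G B u ∪ cn G B v)).card
      < 3 * (cn G B u ∪ cn G B v).card := by
  have := cnt f0 hf H c {u, v} (by simp [insert_subset_iff, hu, hv]) (by simp)
    (fun x hx => (deg2 huv hx).trans (by norm_num)) (fun x hx _ => deg2 huv hx)
  rw [card_pair huv] at this
  simpa using this

lemma deg3 {u v w : V} (h : ¬ (G.Adj u v ∧ G.Adj u w)) :
    (({u, v, w} : Finset V).filter (G.Adj u)).card ≤ 1 := by
  rw [card_le_one]
  intro a ha b hb
  simp only [mem_filter, mem_insert, mem_singleton] at ha hb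
  rcases ha with ⟨rfl | rfl | rfl, h1⟩ <;> rcases hb with ⟨rfl | rfl | rfl, h2⟩ <;>
    simp_all

lemma cnt3 (f0 : ∀ v, 0 ≤ f v) (hf : FBound G f) (H : NoCheap G f) (c : Conf G f B d)
    {u v w : V} (hu : u ∈ B) (hv : v ∈ B) (hw : w ∈ B) (huv : u ≠ v) (huw : u ≠ w) (hvw : v ≠ w)
    (h1 : Dec G B u → ¬ (G.Adj u v ∧ G.Adj u w))
    (h2 : Dec G B v → ¬ (G.Adj v u ∧ G.Adj v w))
    (h3 : Dec G B w → ¬ (G.Adj w u ∧ G.Adj w v)) :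
    3 * d + 1 < (cn G B u ∪ cn G B v ∪ cn G B w).card := by
  have hc : ({u, v, w} : Finset V).card = 3 := card_eq_three.2 ⟨u, v, w, huv, huw, hvw, rfl⟩
  have := cnt f0 hf H c {u, v, w} (by simp [insert_subset_iff, hu, hv, hw]) (by simp)
    (fun x hx => by
      refine (card_filter_le_erase _ _).trans ?_
      rw [card_erase_of_mem hx, hc])
    (fun x hx hD => by
      simp only [mem_insert, mem_singleton] at hx
      rcases hx with rfl | rfl | rfl
      · exact deg3 (h1 hD)
      · rw [insert_comm]; exact deg3 (h2 hD)
      · have : ({u, v, x} : Finset V) = {x, u, v} := by ext; simp; tauto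
        rw [this]; exact deg3 (h3 hD))
  rw [hc] at this
  simp only [biUnion_insert, singleton_biUnion, ← union_assoc] at this
  omega

lemma nb_split {D : Finset V} (hD : D ⊆ B) (v : V) :
    (nb G B v).card = (nb G D v).card + (nb G (B \ D) v).card := by
  rw [← card_union_of_disjoint]
  · congr 1
    ext x
    simp only [mem_union, mem_nb, mem_sdiff]
    have := @hD x
    tauto
  · rw [Finset.disjoint_left]
    intro x hx hx'
    simp only [mem_nb, mem_sdiff] at hx hx'
    tauto

set_option maxHeartbeats 2000000 in
lemma step1 (f0 : ∀ v, 0 ≤ f v) (hf : FBound G f) (H : NoCheap G f) (c : Conf G f B d)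
    (D : Finset V) (hDm : ∀ v, v ∈ D ↔ v ∈ B ∧ (nb G B v).card = d) :
    (∀ u ∈ D, ∀ v ∈ D, ¬ G.Adj u v) ∧
    (∀ x ∈ B \ D, d + 1 ≤ (nb G (B \ D) x).card) := by
  classical
  have hd := c.hd
  have hDB : D ⊆ B := fun v hv => ((hDm v).1 hv).1
  have hDc : ∀ u ∈ D, (cn G B u).card = d + 1 := fun u hu => by
    rw [card_cn, ((hDm u).1 hu).2]
  have self : ∀ u, u ∈ cn G B u := fun u => mem_cn.2 (Or.inl rfl)
  have adjm : ∀ u v, v ∈ B → G.Adj u v → v ∈ cn G B u := fun u v h1 h2 => mem_cn.2 (Or.inr ⟨h1, h2⟩)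
  -- F1
  have F1 : ∀ u ∈ D, ∀ v ∈ D, ¬ G.Adj u v := by
    intro u hu v hv huv
    have h := cnt2 f0 hf H c (hDB hu) (hDB hv) huv.ne
    have hI : ({u, v} : Finset V) ⊆ cn G B u ∩ cn G B v := by
      simp only [insert_subset_iff, singleton_subset_iff, mem_inter]
      exact ⟨⟨self u, adjm _ _ (hDB hu) huv.symm⟩, adjm _ _ (hDB hv) huv, self v⟩
    have h3 := union_card hI
    rw [hDc u hu, hDc v hv, card_pair huv.ne] at h3
    omega
  have F2 : ∀ u ∈ D, ∀ v ∈ D, u ≠ v → ∀ y ∈ B, G.Adj u y → G.Adj v y →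
      ∀ x, x ∈ cn G B u ∪ cn G B v → ¬ Dec G B x := by
    intro u hu v hv huv y hy huy hvy x hx hx'
    have h := cnt2 f0 hf H c (hDB hu) (hDB hv) huv
    have hI : ({y} : Finset V) ⊆ cn G B u ∩ cn G B v := by
      simp only [singleton_subset_iff, mem_inter]
      exact ⟨adjm _ _ hy huy, adjm _ _ hy hvy⟩
    have h3 := union_card hI
    rw [hDc u hu, hDc v hv, card_singleton] at h3
    have := outT_pos hx hx'
    omega
  have F3 : ∀ y ∈ B, (nb G D y).card ≤ 2 := by
    intro y hy
    by_contra! hc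
    obtain ⟨a, b, e, ha, hb, he, hab, hae, hbe⟩ := two_lt_card_iff.1 hc
    rw [mem_nb] at ha hb he
    have h := cnt3 f0 hf H c (hDB ha.1) (hDB hb.1) (hDB he.1) hab hae hbe
      (fun _ h => F1 _ ha.1 _ hb.1 h.1) (fun _ h => F1 _ hb.1 _ ha.1 h.1)
      (fun _ h => F1 _ he.1 _ ha.1 h.1)
    have h1 : ({y} : Finset V) ⊆ cn G B a ∩ cn G B b := by
      simp only [singleton_subset_iff, mem_inter]
      exact ⟨adjm _ _ hy ha.2.symm, adjm _ _ hy hb.2.symm⟩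
    have h2 : ({y} : Finset V) ⊆ (cn G B a ∪ cn G B b) ∩ cn G B e := by
      simp only [singleton_subset_iff, mem_inter, mem_union]
      exact ⟨Or.inl (adjm _ _ hy ha.2.symm), adjm _ _ hy he.2.symm⟩
    have h3 := union_card h1
    have h4 := union_card h2
    rw [hDc _ ha.1, hDc _ hb.1, card_singleton] at h3
    rw [hDc _ he.1, card_singleton] at h4
    omega
  let P : V → V → Prop := fun u w => u ∈ D ∧ w ∈ B ∧ (nb G B w).card = d + 1 ∧ G.Adj u w ∧
    ∀ v ∈ D, G.Adj w v → v = u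
  have F4 : ∀ w ∈ B, w ∉ D → (nb G (B \ D) w).card ≤ d → ∃ u, P u w := by
    intro w hw hwD hle
    have h1 := c.hB w hw
    have h2 : (nb G B w).card ≠ d := fun h => hwD ((hDm w).2 ⟨hw, h⟩)
    have h3 := nb_split hDB (G := G) w
    have h4 := F3 w hw
    by_cases h5 : (nb G D w).card = 1
    · obtain ⟨u, hu⟩ := card_eq_one.1 h5
      have hm : ∀ v, v ∈ D ∧ G.Adj w v ↔ v = u := by
        intro v; rw [← mem_nb, hu, mem_singleton]
      have := (hm u).2 rfl
      exact ⟨u, this.1, hw, by omega, this.2.symm, fun v h h' => (hm v).1 ⟨h, h'⟩⟩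
    · exfalso
      obtain ⟨a, b, hab, hs⟩ := card_eq_two.1 (by omega : (nb G D w).card = 2)
      have ha : a ∈ nb G D w := by rw [hs]; simp
      have hb : b ∈ nb G D w := by rw [hs]; simp
      rw [mem_nb] at ha hb
      have hwa : a ≠ w := ha.2.ne'
      have hwb : w ≠ b := hb.2.ne
      have h := cnt3 f0 hf H c (hDB ha.1) hw (hDB hb.1) hwa hab hwb
        (fun _ h => F1 _ ha.1 _ hb.1 h.2)
        (fun hD _ => F2 a ha.1 b hb.1 hab w hw ha.2.symm hb.2.symm w
          (mem_union_left _ (adjm _ _ hw ha.2.symm)) hD)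
        (fun _ h => F1 _ hb.1 _ ha.1 h.1)
      have h1 : ({a, w} : Finset V) ⊆ cn G B a ∩ cn G B w := by
        simp only [insert_subset_iff, singleton_subset_iff, mem_inter]
        exact ⟨⟨self _, adjm _ _ (hDB ha.1) ha.2⟩, adjm _ _ hw ha.2.symm, self _⟩
      have h2 : ({w, b} : Finset V) ⊆ (cn G B a ∪ cn G B w) ∩ cn G B b := by
        simp only [insert_subset_iff, singleton_subset_iff, mem_inter, mem_union]
        exact ⟨⟨Or.inr (self _), adjm _ _ hw hb.2.symm⟩, Or.inr (adjm _ _ (hDB hb.1) hb.2), self _⟩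
      have h3' := union_card h1
      have h4' := union_card h2
      rw [hDc _ ha.1, card_cn, card_pair hwa] at h3'
      rw [hDc _ hb.1, card_pair hwb] at h4'
      omega
  have P2 : ∀ u w, P u w → (cn G B u ∪ cn G B w).card ≤ 2 * d + 1 := by
    rintro u w ⟨hu, hw, hwc, huw, _⟩
    have h1 : ({u, w} : Finset V) ⊆ cn G B u ∩ cn G B w := by
      simp only [insert_subset_iff, singleton_subset_iff, mem_inter]
      exact ⟨⟨self _, adjm _ _ (hDB hu) huw.symm⟩, adjm _ _ hw huw, self _⟩
    have h2 := union_card h1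
    rw [hDc _ hu, card_cn, card_pair huw.ne] at h2
    omega
  have F5 : ∀ u w, P u w → ∀ x, x ∈ cn G B u ∪ cn G B w → ¬ Dec G B x := by
    intro u w hP x hx hD
    have h2 := P2 u w hP
    obtain ⟨hu, hw, hwc, huw, _⟩ := hP
    have h := cnt2 f0 hf H c (hDB hu) hw huw.ne
    have := outT_pos hx hD
    omega
  have Fu : ∀ u w, P u w → ¬ Dec G B u := fun u w h => F5 u w h u (mem_union_left _ (self _))
  have Fw : ∀ u w, P u w → ¬ Dec G B w := fun u w h => F5 u w h w (mem_union_right _ (self _))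
  have F6 : ∀ u w w', P u w → P u w' → w = w' := by
    intro u w w' hP hP'
    by_contra hne
    have h2 := P2 u w hP
    have ⟨hu, hw, hwc, huw, _⟩ := hP
    have ⟨_, hw', hwc', huw', _⟩ := hP'
    have h := cnt3 f0 hf H c (hDB hu) hw hw' huw.ne huw'.ne hne
      (fun h => absurd h (Fu _ _ hP)) (fun h => absurd h (Fw _ _ hP))
      (fun h => absurd h (Fw _ _ hP'))
    have h1 : ({u, w'} : Finset V) ⊆ (cn G B u ∪ cn G B w) ∩ cn G B w' := by
      simp only [insert_subset_iff, singleton_subset_iff, mem_inter, mem_union]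
      exact ⟨⟨Or.inl (self _), adjm _ _ (hDB hu) huw'.symm⟩, Or.inl (adjm _ _ hw' huw'), self _⟩
    have h3 := union_card h1
    rw [card_cn, card_pair huw'.ne] at h3
    omega
  have F7 : ∀ u w u' w', P u w → P u' w' → ¬ G.Adj w w' := by
    intro u w u' w' hP hP' hadj
    have h2 := P2 u w hP
    have ⟨hu, hw, hwc, huw, _⟩ := hP
    have ⟨_, hw', hwc', _, _⟩ := hP'
    have huw' : u ≠ w' := by
      rintro rfl
      have := ((hDm _).1 hu).2
      omega
    have h := cnt3 f0 hf H c (hDB hu) hw hw' huw.ne huw' hadj.ne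
      (fun h => absurd h (Fu _ _ hP)) (fun h => absurd h (Fw _ _ hP))
      (fun h => absurd h (Fw _ _ hP'))
    have h1 : ({w, w'} : Finset V) ⊆ (cn G B u ∪ cn G B w) ∩ cn G B w' := by
      simp only [insert_subset_iff, singleton_subset_iff, mem_inter, mem_union]
      exact ⟨⟨Or.inr (self _), adjm _ _ hw hadj.symm⟩, Or.inr (adjm _ _ hw' hadj), self _⟩
    have h3 := union_card h1
    rw [card_cn, card_pair hadj.ne] at h3
    omega
  have F8a : ∀ u w u' w' x, P u w → P u' w' → x ∈ B → G.Adj w x → G.Adj w' x → w = w' := by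
    intro u w u' w' x hP hP' hx hwx hwx'
    by_contra hne
    have h2 := P2 u w hP
    have h2' := P2 u' w' hP'
    have hww := F7 _ _ _ _ hP hP'
    have hww' := F7 _ _ _ _ hP' hP
    have huu : u ≠ u' := by rintro rfl; exact hne (F6 _ _ _ hP hP')
    have ⟨hu, hw, hwc, huw, hun⟩ := hP
    have ⟨hu', hw', hwc', huw', hun'⟩ := hP'
    have a1 : ¬ G.Adj u u' := F1 _ hu _ hu'
    have a1' : ¬ G.Adj u' u := F1 _ hu' _ hu
    have a2 : ¬ G.Adj w' u := fun h => huu (hun' u hu h)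
    have a2' : ¬ G.Adj u w' := fun h => a2 h.symm
    have a3 : ¬ G.Adj w u' := fun h => huu (hun u' hu' h).symm
    have a3' : ¬ G.Adj u' w := fun h => a3 h.symm
    have n1 : u ≠ w' := by
      rintro rfl
      have := ((hDm _).1 hu).2
      omega
    have n2 : w ≠ u' := by
      rintro rfl
      have := ((hDm _).1 hu').2
      omega
    have hdeg : ∀ v ∈ ({u, w, u', w'} : Finset V),
        (({u, w, u', w'} : Finset V).filter (G.Adj v)).card ≤ 1 := by
      intro v hv
      rw [card_le_one]
      intro a ha b hb
      simp only [mem_filter, mem_insert, mem_singleton] at ha hb hv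
      have i1 := G.irrefl (v := u)
      have i2 := G.irrefl (v := w)
      have i3 := G.irrefl (v := u')
      have i4 := G.irrefl (v := w')
      obtain ⟨ha, ha'⟩ := ha
      obtain ⟨hb, hb'⟩ := hb
      rcases hv with hv | hv | hv | hv <;> rw [hv] at ha' hb' <;>
      rcases ha with h | h | h | h <;> rw [h] at ha' ⊢ <;> (try contradiction) <;>
      rcases hb with h | h | h | h <;> rw [h] at hb' ⊢ <;> contradiction
    have h := cnt f0 hf H c {u, w, u', w'}
      (by simp [insert_subset_iff, hDB hu, hw, hDB hu', hw']) (by simp)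
      (fun v hv => (hdeg v hv).trans (by norm_num)) (fun v hv _ => hdeg v hv)
    have hc : ({u, w, u', w'} : Finset V).card = 4 := by
      rw [card_insert_of_notMem, card_insert_of_notMem, card_pair huw'.ne]
      · simp [n2, hne]
      · simp [huw.ne, huu, n1]
    rw [hc] at h
    simp only [biUnion_insert, singleton_biUnion, ← union_assoc] at h
    rw [union_assoc (cn G B u ∪ cn G B w)] at h
    have h1 : ({x} : Finset V) ⊆ (cn G B u ∪ cn G B w) ∩ (cn G B u' ∪ cn G B w') := by
      simp only [singleton_subset_iff, mem_inter, mem_union]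
      exact ⟨Or.inr (adjm _ _ hx hwx), Or.inr (adjm _ _ hx hwx')⟩
    have h3 := union_card h1
    rw [card_singleton] at h3
    omega
  have F8b : ∀ u w x, P u w → x ∈ B → G.Adj w x → x ∉ D → ∀ v ∈ D, ¬ G.Adj x v := by
    intro u w x hP hx hwx hxD v hv hxv
    have h2 := P2 u w hP
    have ⟨hu, hw, hwc, huw, hun⟩ := hP
    by_cases hvu : v = u
    · subst hvu
      have h := cnt2 f0 hf H c (hDB hv) hw huw.ne
      have h1 : ({v, w, x} : Finset V) ⊆ cn G B v ∩ cn G B w := by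
        simp only [insert_subset_iff, singleton_subset_iff, mem_inter]
        exact ⟨⟨self _, adjm _ _ (hDB hv) huw.symm⟩, ⟨adjm _ _ hw huw, self _⟩,
          adjm _ _ hx hxv.symm, adjm _ _ hx hwx⟩
      have h3 := union_card h1
      rw [hDc _ hv, card_cn,
        card_eq_three.2 ⟨v, w, x, huw.ne, hxv.ne', hwx.ne, rfl⟩] at h3
      omega
    · have hwv : ¬ G.Adj w v := fun h => hvu (hun v hv h)
      have n1 : w ≠ v := by
        rintro rfl
        have := ((hDm _).1 hv).2
        omega
      have h := cnt3 f0 hf H c (hDB hu) hw (hDB hv) huw.ne (Ne.symm hvu) n1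
        (fun _ h => F1 _ hu _ hv h.2) (fun _ h => hwv h.2) (fun _ h => hwv h.2.symm)
      have h1 : ({x} : Finset V) ⊆ (cn G B u ∪ cn G B w) ∩ cn G B v := by
        simp only [singleton_subset_iff, mem_inter, mem_union]
        exact ⟨Or.inr (adjm _ _ hx hwx), adjm _ _ hx hxv.symm⟩
      have h3 := union_card h1
      rw [card_singleton, hDc _ hv] at h3
      omega
  let W : Finset V := B.filter (fun w => ∃ u, P u w)
  have hWm : ∀ w, w ∈ W ↔ ∃ u, P u w := by
    intro w
    simp only [W, mem_filter]
    exact ⟨fun h => h.2, fun h => ⟨h.choose_spec.2.1, h⟩⟩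
  have hWD : ∀ w ∈ W, w ∉ D := by
    intro w hw hD
    obtain ⟨u, hP⟩ := (hWm w).1 hw
    have := ((hDm _).1 hD).2
    have := hP.2.2.1
    omega
  have hWB : W ⊆ B \ D := fun w hw => by
    obtain ⟨u, hP⟩ := (hWm w).1 hw
    exact mem_sdiff.2 ⟨hP.2.1, hWD w hw⟩
  have F8 : ∀ x ∈ (B \ D) \ W, d + 1 ≤ (nb G ((B \ D) \ W) x).card := by
    intro x hx
    simp only [mem_sdiff] at hx
    obtain ⟨⟨hxB, hxD⟩, hxW⟩ := hx
    by_contra! hlt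
    have h1 : ¬ (nb G (B \ D) x).card ≤ d := fun h => hxW ((hWm x).2 (F4 x hxB hxD h))
    have h2 := nb_split hWB (G := G) x
    have h3 := nb_split hDB (G := G) x
    obtain ⟨w, hw⟩ := card_pos.1 (by omega : 0 < (nb G W x).card)
    rw [mem_nb] at hw
    obtain ⟨u, hP⟩ := (hWm w).1 hw.1
    have h4 : (nb G W x).card ≤ 1 := by
      rw [card_le_one]
      intro a ha b hb
      rw [mem_nb] at ha hb
      obtain ⟨ua, hPa⟩ := (hWm a).1 ha.1
      obtain ⟨ub, hPb⟩ := (hWm b).1 hb.1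
      exact F8a _ _ _ _ x hPa hPb hxB ha.2.symm hb.2.symm
    have hDx := F8b u w x hP hxB hw.2.symm hxD
    have h5 : (nb G D x).card = 0 := by
      rw [card_eq_zero, eq_empty_iff_forall_notMem]
      intro v hv
      rw [mem_nb] at hv
      exact hDx v hv.1 hv.2
    have h6 := P2 u w hP
    have ⟨hu, hwB, hwc, huw, hun⟩ := hP
    have hux : u ≠ x := by rintro rfl; exact hxD hu
    have h := cnt3 f0 hf H c (hDB hu) hwB hxB huw.ne hux hw.2.ne'
      (fun h => absurd h (Fu _ _ hP)) (fun h => absurd h (Fw _ _ hP))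
      (fun _ h => hDx u hu h.1)
    have h1 : ({w, x} : Finset V) ⊆ (cn G B u ∪ cn G B w) ∩ cn G B x := by
      simp only [insert_subset_iff, singleton_subset_iff, mem_inter, mem_union]
      exact ⟨⟨Or.inr (self _), adjm _ _ hwB hw.2⟩, Or.inr (adjm _ _ hxB hw.2.symm), self _⟩
    have h3 := union_card h1
    rw [card_cn, card_pair hw.2.ne'] at h3
    omega
  have hW0 : W = ∅ := by
    rw [eq_empty_iff_forall_notMem]
    intro w hw
    obtain ⟨u, hP⟩ := (hWm w).1 hw
    have h6 := P2 u w hP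
    have ⟨hu, hwB, hwc, huw, hun⟩ := hP
    have hcov : ({u, w} : Finset V).biUnion (cn G B) = cn G B u ∪ cn G B w := by simp
    have hsub : ({u, w} : Finset V) ⊆ cn G B u ∪ cn G B w := by
      simp only [insert_subset_iff, singleton_subset_iff, mem_union]
      exact ⟨Or.inl (self _), Or.inr (self _)⟩
    have h := wcnt f0 hf H c {u, w} ((cn G B u ∪ cn G B w) \ {u, w}) ((B \ D) \ W)
      (by rw [hcov]; intro x; simp only [mem_union, mem_sdiff]; tauto) F8
      (by
        intro x hx
        simp only [mem_sdiff, mem_union, mem_cn, mem_insert, mem_singleton, not_or] at hx ⊢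
        obtain ⟨hx1, hxu, hxw⟩ := hx
        rcases hx1 with (h | ⟨hxB, hx1⟩) | (h | ⟨hxB, hx1⟩)
        · exact absurd h hxu
        · refine ⟨⟨hxB, fun h => F1 _ hu _ h hx1⟩, fun h => ?_⟩
          obtain ⟨u', hP'⟩ := (hWm x).1 h
          have : u = u' := hP'.2.2.2.2 u hu hx1.symm
          subst this
          exact hxw (F6 _ _ _ hP' hP)
        · exact absurd h hxw
        · refine ⟨⟨hxB, fun h => hxu (hun x h hx1)⟩, fun h => ?_⟩
          obtain ⟨u', hP'⟩ := (hWm x).1 h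
          exact F7 _ _ _ _ hP hP' hx1)
      (by simp [insert_subset_iff, hDB hu, hwB]) (by simp)
      (fun x hx => (deg2 huw.ne hx).trans (by norm_num)) (fun x hx _ => deg2 huw.ne hx)
    have hR : ((cn G B u ∪ cn G B w) \ {u, w}).card ≤ 2 * d - 1 := by
      rw [card_sdiff_of_subset hsub, card_pair huw.ne]; omega
    have hR' : (((cn G B u ∪ cn G B w) \ {u, w}).card : ℝ) ≤ 2 * d - 1 := by
      have : ((cn G B u ∪ cn G B w) \ {u, w}).card + 1 ≤ 2 * d := by omega
      have : (((cn G B u ∪ cn G B w) \ {u, w}).card : ℝ) + 1 ≤ 2 * d := by exact_mod_cast this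
      linarith
    rw [card_pair huw.ne] at h
    have hd' : (1:ℝ) ≤ d := by exact_mod_cast hd
    have hT : (0:ℝ) ≤ (outT G B (({u, w} : Finset V).biUnion (cn G B))).card / (3 * d + 1) := by
      positivity
    have hm : (((cn G B u ∪ cn G B w) \ {u, w}).card : ℝ) * (3 / (3 * d + 4)) ≤
        (2 * d - 1) * (3 / (3 * d + 4)) := by gcongr
    have hfin : (2:ℝ) * (3 / (3 * d + 1)) + (2 * d - 1) * (3 / (3 * d + 4)) ≤ 2 := by
      rw [mul_div_assoc', mul_div_assoc', div_add_div _ _ (by positivity) (by positivity),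
        div_le_iff₀ (by positivity)]
      nlinarith
    push_cast at h
    linarith
  refine ⟨F1, ?_⟩
  rw [hW0, sdiff_empty] at F8
  exact F8

set_option maxHeartbeats 1000000 in
lemma step2 (f0 : ∀ v, 0 ≤ f v) (hf : FBound G f) (H : NoCheap G f) (c : Conf G f B d)
    (D : Finset V) (hDm : ∀ v, v ∈ D ↔ v ∈ B ∧ (nb G B v).card = d) (hne : D.Nonempty) :
    Conf G f (B \ D) (d + 1) := by
  obtain ⟨F1, F8⟩ := step1 f0 hf H c D hDm
  have hd := c.hd
  have hd' : (1:ℝ) ≤ d := by exact_mod_cast hd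
  have hDB : D ⊆ B := fun v hv => ((hDm v).1 hv).1
  have hnbD : ∀ u ∈ D, nb G B u ⊆ B \ D := by
    intro u hu x hx
    rw [mem_nb] at hx
    exact mem_sdiff.2 ⟨hx.1, fun h => F1 _ hu _ h hx.2⟩
  have hone : ∀ u ∈ D, (1:ℝ) + (outT G B (cn G B u)).card / (3 * d + 1)
      < 3 / (3 * d + 1) + d * (3 / (3 * d + 4)) := by
    intro u hu
    have h := wcnt f0 hf H c {u} (nb G B u) (B \ D) (by
        intro x hx; simpa [cn] using hx) F8 (hnbD u hu) (by simpa using hDB hu) (by simp)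
        (fun x hx => ((card_filter_le_erase _ _).trans (by rw [card_erase_of_mem hx]; simp)))
        (fun x hx _ => ((card_filter_le_erase _ _).trans (by rw [card_erase_of_mem hx]; simp)))
    rw [((hDm u).1 hu).2] at h
    simpa using h
  have hd2 : d ≤ 2 := by
    obtain ⟨u, hu⟩ := hne
    have h := hone u hu
    by_contra! hc
    have hc' : (3:ℝ) ≤ d := by exact_mod_cast hc
    have hT : (0:ℝ) ≤ (outT G B (cn G B u)).card / (3 * d + 1) := by positivity
    have : (3:ℝ) / (3 * d + 1) + d * (3 / (3 * d + 4)) ≤ 1 := by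
      rw [mul_div_assoc', div_add_div _ _ (by positivity) (by positivity),
        div_le_iff₀ (by positivity)]
      nlinarith
    linarith
  have hund : ∀ u ∈ D, ∀ x ∈ cn G B u, ¬ Dec G B x := by
    intro u hu x hx hD
    have h := hone u hu
    have h1 : (1:ℝ) ≤ (outT G B (cn G B u)).card := by exact_mod_cast outT_pos hx hD
    have h2 : (1:ℝ) / (3 * d + 1) ≤ (outT G B (cn G B u)).card / (3 * d + 1) := by gcongr
    have h3 : (3:ℝ) / (3 * d + 1) + d * (3 / (3 * d + 4)) ≤ 1 + 1 / (3 * d + 1) := by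
      have : (1:ℝ) + 1 / (3 * d + 1) = (3 * d + 2) / (3 * d + 1) := by field_simp; ring
      rw [this, mul_div_assoc', div_add_div _ _ (by positivity) (by positivity),
        div_le_div_iff₀ (by positivity) (by positivity)]
      have : (0:ℝ) < 3 * d + 1 := by positivity
      nlinarith [mul_nonneg this.le (sub_nonneg.2 hd'), mul_nonneg this.le (mul_nonneg this.le (sub_nonneg.2 hd'))]
    linarith
  have hshare : ∀ u ∈ D, ∀ v ∈ D, ∀ y ∈ B, G.Adj u y → G.Adj v y → u = v := by
    intro u hu v hv y hy huy hvy
    by_contra huv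
    have h := wcnt f0 hf H c {u, v} (nb G B u ∪ nb G B v) (B \ D) (by
        intro x hx
        simp only [mem_biUnion, mem_insert, mem_singleton, cn, mem_union] at hx ⊢
        obtain ⟨a, rfl | rfl, hx⟩ := hx <;> tauto) F8
        (union_subset (hnbD u hu) (hnbD v hv))
        (by simp [insert_subset_iff, hDB hu, hDB hv]) (by simp)
        (fun x hx => (deg2 huv hx).trans (by norm_num)) (fun x hx _ => deg2 huv hx)
    have h1 : ({y} : Finset V) ⊆ nb G B u ∩ nb G B v := by
      simp only [singleton_subset_iff, mem_inter, mem_nb]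
      exact ⟨⟨hy, huy⟩, hy, hvy⟩
    have h2 := union_card h1
    rw [((hDm u).1 hu).2, ((hDm v).1 hv).2, card_singleton] at h2
    have h3 : ((nb G B u ∪ nb G B v).card : ℝ) + 1 ≤ d + d := by exact_mod_cast h2
    have h3' : ((nb G B u ∪ nb G B v).card : ℝ) ≤ 2 * d - 1 := by linarith
    rw [card_pair huv] at h
    have hT : (0:ℝ) ≤ (outT G B (({u, v} : Finset V).biUnion (cn G B))).card / (3 * d + 1) := by
      positivity
    have hm : ((nb G B u ∪ nb G B v).card : ℝ) * (3 / (3 * d + 4)) ≤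
        (2 * d - 1) * (3 / (3 * d + 4)) := by gcongr
    have hfin : (2:ℝ) * (3 / (3 * d + 1)) + (2 * d - 1) * (3 / (3 * d + 4)) ≤ 2 := by
      rw [mul_div_assoc', mul_div_assoc', div_add_div _ _ (by positivity) (by positivity),
        div_le_iff₀ (by positivity)]
      nlinarith
    push_cast at h
    linarith
  have hself : ∀ u, u ∈ cn G B u := fun u => mem_cn.2 (Or.inl rfl)
  have hDN : ∀ u ∈ D, ∀ y, G.Adj u y → y ∈ B \ D := by
    intro u hu y huy
    have : y ∈ B := by
      by_contra hy
      exact hund u hu u (hself u) ⟨y, hy, huy⟩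
    exact mem_sdiff.2 ⟨this, fun h => F1 _ hu _ h huy⟩
  have hnot : ∀ z, z ∉ B \ D → z ∉ B ∨ z ∈ D := by
    intro z; simp only [mem_sdiff]; tauto
  have hNF : ∀ z ∈ D, G.neighborFinset z = nb G B z := by
    intro z hz
    ext x
    rw [mem_nb, mem_neighborFinset]
    exact ⟨fun h => ⟨(mem_sdiff.1 (hDN z hz x h)).1, h⟩, fun h => h.2⟩
  refine ⟨by omega, F8, ?_, ?_, ?_, ?_⟩
  · intro v hv z z' hz hz' hvz hvz'
    have hvB := (mem_sdiff.1 hv).1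
    rcases hnot z hz with h | h <;> rcases hnot z' hz' with h' | h'
    · exact c.out1 v hvB z z' h h' hvz hvz'
    · exact absurd ⟨z, h, hvz⟩ (hund z' h' v (mem_cn.2 (Or.inr ⟨hvB, hvz'.symm⟩)))
    · exact absurd ⟨z', h', hvz'⟩ (hund z h v (mem_cn.2 (Or.inr ⟨hvB, hvz.symm⟩)))
    · exact hshare z h z' h' v hvB hvz.symm hvz'.symm
  · intro z hz y hzy
    rcases hnot z hz with h | h
    · refine mem_sdiff.2 ⟨c.outB z h y hzy, fun hy => ?_⟩
      exact hund y hy y (hself y) ⟨z, h, hzy.symm⟩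
    · exact hDN z h y hzy
  · intro z hz
    rcases hnot z hz with h | h
    · exact c.out2 z h
    · rw [hNF z h, ((hDm z).1 h).2]; exact hd2
  · intro z hz y hzy
    rcases hnot z hz with h | h
    · refine (c.gain z h y hzy).trans ?_
      push_cast
      gcongr
      linarith
    · have h1 := hf B d c.hB z (hDB h)
      have h2 : ∑ x ∈ (G.neighborFinset z).erase y, f x ≤
          ∑ x ∈ (G.neighborFinset z).erase y, 3 / (3 * (d:ℝ) + 4) := by
        refine sum_le_sum fun x hx => ?_
        have hx' := mem_of_mem_erase hx
        rw [mem_neighborFinset] at hx'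
        exact (hf (B \ D) (d + 1) F8 x (hDN z h x hx')).trans (le_of_eq (by push_cast; ring))
      rw [sum_const, nsmul_eq_mul, card_erase_of_mem (by simpa using hzy), hNF z h,
        ((hDm z).1 h).2, Nat.cast_sub hd] at h2
      have h3 : (3:ℝ) / (3 * d + 1) + (d - 1) * (3 / (3 * d + 4)) ≤ 1 - 1 / (3 * d + 4) := by
        have : (1:ℝ) - 1 / (3 * d + 4) = (3 * d + 3) / (3 * d + 4) := by field_simp; ring
        rw [this, mul_div_assoc', div_add_div _ _ (by positivity) (by positivity),
          div_le_div_iff₀ (by positivity) (by positivity)]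
        have : (0:ℝ) < 3 * d + 4 := by positivity
        nlinarith [mul_nonneg this.le (sub_nonneg.2 hd'), mul_nonneg this.le (mul_nonneg this.le (sub_nonneg.2 hd'))]
      have h4 : (1:ℝ) - 1 / (3 * d + 4) = 1 - 1 / (3 * ((d + 1 : ℕ) : ℝ) + 1) := by
        push_cast; ring
      rw [← h4, hNF z h]
      push_cast at h2
      linarith

lemma no_conf (f0 : ∀ v, 0 ≤ f v) (hf : FBound G f) (H : NoCheap G f) (n : ℕ) :
    ∀ (B : Finset V) (d : ℕ), B.card = n → B.Nonempty → Conf G f B d → False := by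
  induction n using Nat.strong_induction_on with
  | _ n ih =>
    intro B d hn hne c
    obtain ⟨u, hu, hmin⟩ := exists_min_image B (fun v => (nb G B v).card) hne
    have hdu := c.hB u hu
    set e := (nb G B u).card with he
    have hde : (d:ℝ) ≤ e := by exact_mod_cast hdu
    have c' : Conf G f B e := by
      refine ⟨c.hd.trans hdu, hmin, c.out1, c.outB, c.out2, fun z hz y hzy => ?_⟩
      refine (c.gain z hz y hzy).trans ?_
      gcongr
    have huD : u ∈ B.filter (fun v => (nb G B v).card = e) := by simp [hu, ← he]
    have c2 := step2 f0 hf H c' (B.filter (fun v => (nb G B v).card = e)) (by simp) ⟨u, huD⟩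
    obtain ⟨F1, _⟩ := step1 f0 hf H c' (B.filter (fun v => (nb G B v).card = e)) (by simp)
    have hpos := c'.hd
    obtain ⟨w, hw⟩ := card_pos.1 (by omega : 0 < (nb G B u).card)
    rw [mem_nb] at hw
    refine ih _ ?_ _ _ rfl ⟨w, mem_sdiff.2 ⟨hw.1, fun h => F1 _ huD _ h hw.2⟩⟩ c2
    rw [← hn]
    exact card_lt_card ⟨sdiff_subset, fun h => (mem_sdiff.1 (h hu)).2 huD⟩

lemma le_zeta (B : Finset V) (d : ℕ) (h : ∀ v ∈ B, d ≤ (nb G B v).card) (v : V) (hv : v ∈ B) :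
    d ≤ zeta G v := by
  have hbdd : BddAbove {n | ∃ H : G.Subgraph, v ∈ H.verts ∧ subMinDeg G H = n} := by
    refine ⟨Fintype.card V, ?_⟩
    rintro n ⟨K, hK, rfl⟩
    have h1 : subMinDeg G K ≤ (K.neighborSet v).ncard := Nat.sInf_le ⟨v, hK, rfl⟩
    refine h1.trans ?_
    rw [← Nat.card_eq_fintype_card]
    exact Set.ncard_le_card _
  refine le_trans ?_ (le_csSup hbdd ⟨(⊤ : G.Subgraph).induce (B : Set V), by simpa using hv, rfl⟩)
  refine le_csInf (Set.Nonempty.image _ ⟨v, by simpa using hv⟩) ?_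
  rintro n ⟨x, hx, rfl⟩
  have hx' : x ∈ B := by simpa using hx
  refine (h x hx').trans (le_of_eq ?_)
  rw [← Set.ncard_coe_finset]
  congr 1
  ext y
  simp [mem_nb, hx']

end Helpers

theorem stmt_17 {V : Type*} [Fintype V] [DecidableEq V] [Nonempty V]
    (G : SimpleGraph V) [DecidableRel G.Adj] :
    ∃ S : Finset V, TwoCheap G S := by
  by_contra! hno
  have hiso : ∀ v, 0 < G.degree v := by
    intro v
    by_contra hv
    exact hno {v} ⟨by simp, Or.inl (by simpa using hv)⟩
  have f0 : ∀ v, (0:ℝ) ≤ 1 / (zeta G v + 1/3) := fun v => by positivity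
  have hf : FBound G (fun v => (1:ℝ) / (zeta G v + 1/3)) := by
    intro B d h v hv
    have := le_zeta B d h v hv
    have h' : (d:ℝ) ≤ zeta G v := by exact_mod_cast this
    simp only
    rw [div_le_div_iff₀ (by positivity) (by positivity)]
    linarith
  have H : NoCheap G (fun v => (1:ℝ) / (zeta G v + 1/3)) := by
    intro S h1 h2 h3
    by_contra! h4
    exact hno S ⟨h1, Or.inr ⟨h2, h3, h4⟩⟩
  refine no_conf f0 hf H _ univ 1 rfl univ_nonempty ⟨le_rfl, ?_, ?_, ?_, ?_, ?_⟩
  · intro v _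
    have : nb G univ v = G.neighborFinset v := by ext; simp [mem_nb]
    rw [this]
    exact hiso v
  · intro v _ z z' hz; simp at hz
  · intro z hz; simp at hz
  · intro z hz; simp at hz
  · intro z hz; simp at hz
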